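/- Let 𝒜 be an abelian category, ℰ a full additive subcategory, and 𝒯 an ℰ-preresolving subcategory of 𝒜 admitting an ℰ-proper generator 𝒞. For any object A of 𝒜 and any n ≥ 0, the following are equivalent: (1) 𝒯-dim A ≤ n; (2) there exists an exact sequence 0 → K_n → C_{n-1} → C_{n-2} → ⋯ → C₀ → A → 0 in 𝒜 with all C_i objects in 𝒞 and K_n an object in 𝒯. -/

import Mathlib

open CategoryTheory CategoryTheory.Limits CategoryTheory.Abelian ZeroObject

universe w v u

namespace RelHomDim

variable {𝒜 : Type u} [Category.{v} 𝒜] [Abelian 𝒜]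

/-- A class of objects of an abelian category corresponding to a full additive
subcategory: it is closed under isomorphisms, contains a zero object and is
closed under finite direct sums (biproducts). -/
def IsAdditiveClass (P : 𝒜 → Prop) : Prop :=
  P 0 ∧ (∀ ⦃X Y : 𝒜⦄, (X ≅ Y) → P X → P Y) ∧ ∀ ⦃X Y : 𝒜⦄, P X → P Y → P (X ⊞ Y)

/-- A class of objects is closed under direct summands. -/
def ClosedUnderSummands (P : 𝒜 → Prop) : Prop :=
  ∀ X Y : 𝒜, P (X ⊞ Y) → P X ∧ P Y

/-- `Hom(W,-)`-exactness of a short exact sequence `0 → X₁ → X₂ → X₃ → 0`: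
the induced sequence `0 → Hom(W,X₁) → Hom(W,X₂) → Hom(W,X₃) → 0` is exact. -/
def CovHomExact (W : 𝒜) (S : ShortComplex 𝒜) : Prop :=
  (∀ a b : W ⟶ S.X₁, a ≫ S.f = b ≫ S.f → a = b) ∧
  (∀ b : W ⟶ S.X₂, b ≫ S.g = 0 → ∃ a : W ⟶ S.X₁, a ≫ S.f = b) ∧
  (∀ c : W ⟶ S.X₃, ∃ b : W ⟶ S.X₂, b ≫ S.g = c)

/-- A short exact sequence is `ℰ`-proper (i.e. `Hom(ℰ,-)`-exact) if it is
`Hom(E,-)`-exact for every object `E` in the class `ℰ`. -/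
def EProper (E : 𝒜 → Prop) (S : ShortComplex 𝒜) : Prop :=
  ∀ W, E W → CovHomExact W S

/-- `ResW P W n K A` holds iff there is an exact sequence
`0 → K → X_{n-1} → ⋯ → X_0 → A → 0` in `𝒜` with all the `n` middle terms `X i`
in `P`, such that each of the short exact sequences obtained by splicing
satisfies `W` (this encodes, e.g., `Hom(ℰ,-)`-exactness of the whole sequence). -/
def ResW (P : 𝒜 → Prop) (W : ShortComplex 𝒜 → Prop) : ℕ → 𝒜 → 𝒜 → Prop
  | 0 => fun K A => Nonempty (K ≅ A)
  | n + 1 => fun K A => ∃ (B X : 𝒜) (f : B ⟶ X) (g : X ⟶ A) (w : f ≫ g = 0),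
      P X ∧ (ShortComplex.mk f g w).ShortExact ∧ W (ShortComplex.mk f g w) ∧
      ResW P W n K B

/-- `Res P n K A` : there is an exact sequence `0 → K → X_{n-1} → ⋯ → X_0 → A → 0`
with all middle terms in `P`. -/
abbrev Res (P : 𝒜 → Prop) : ℕ → 𝒜 → 𝒜 → Prop := ResW P fun _ => True

/-- `CoresW P W n A K` holds iff there is an exact sequence
`0 → A → X^0 → ⋯ → X^{n-1} → K → 0` with all middle terms in `P` and each
spliced short exact piece satisfying `W`. -/
def CoresW (P : 𝒜 → Prop) (W : ShortComplex 𝒜 → Prop) : ℕ → 𝒜 → 𝒜 → Prop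
  | 0 => fun A K => Nonempty (A ≅ K)
  | n + 1 => fun A K => ∃ (X B : 𝒜) (f : A ⟶ X) (g : X ⟶ B) (w : f ≫ g = 0),
      P X ∧ (ShortComplex.mk f g w).ShortExact ∧ W (ShortComplex.mk f g w) ∧
      CoresW P W n B K

/-- `Cores P n A K` : there is an exact sequence `0 → A → X^0 → ⋯ → X^{n-1} → K → 0`
with all middle terms in `P`. -/
abbrev Cores (P : 𝒜 → Prop) : ℕ → 𝒜 → 𝒜 → Prop := CoresW P fun _ => True

/-- The `P`-dimension of `A` : the infimum of the `n ≥ 0` such that there is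
an exact sequence `0 → C_n → ⋯ → C_1 → C_0 → A → 0` with all `C_i` in `P`
(`⊤ = ∞` if there is no such `n`). -/
noncomputable def rdim (P : 𝒜 → Prop) (A : 𝒜) : ℕ∞ :=
  sInf {c : ℕ∞ | ∃ n : ℕ, c = n ∧ ∃ K, P K ∧ Res P n K A}

/-- The `P`-codimension of `A` : the infimum of the `n ≥ 0` such that there is
an exact sequence `0 → A → C^0 → C^1 → ⋯ → C^n → 0` with all `C^i` in `P`
(`⊤ = ∞` if there is no such `n`). -/
noncomputable def rcodim (P : 𝒜 → Prop) (A : 𝒜) : ℕ∞ :=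
  sInf {c : ℕ∞ | ∃ n : ℕ, c = n ∧ ∃ K, P K ∧ Cores P n A K}

/-- `A` belongs to `P^⊥`, i.e. `Ext^i(C, A) = 0` for all `C` in `P` and `i ≥ 1`. -/
def MemRightPerp [HasExt.{w} 𝒜] (P : 𝒜 → Prop) (A : 𝒜) : Prop :=
  ∀ C, P C → ∀ i : ℕ, 1 ≤ i → Subsingleton (Abelian.Ext C A i)

/-- `A` belongs to `^⊥P`, i.e. `Ext^i(A, C) = 0` for all `C` in `P` and `i ≥ 1`. -/
def MemLeftPerp [HasExt.{w} 𝒜] (P : 𝒜 → Prop) (A : 𝒜) : Prop :=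
  ∀ C, P C → ∀ i : ℕ, 1 ≤ i → Subsingleton (Abelian.Ext A C i)

/-- `𝒞` is an `ℰ`-proper generator for `𝒯` (`𝒞 ⊆ 𝒯` and every object of `𝒯`
is an `ℰ`-proper quotient of an object of `𝒞` with kernel in `𝒯`). -/
def IsProperGenerator (E C T : 𝒜 → Prop) : Prop :=
  (∀ ⦃X⦄, C X → T X) ∧
  ∀ X, T X → ∃ (X' Cb : 𝒜) (f : X' ⟶ Cb) (g : Cb ⟶ X) (w : f ≫ g = 0),
    C Cb ∧ T X' ∧ (ShortComplex.mk f g w).ShortExact ∧ EProper E (ShortComplex.mk f g w)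

/-- `𝒞` is a cogenerator for `𝒯`. -/
def IsCogenerator (C T : 𝒜 → Prop) : Prop :=
  (∀ ⦃X⦄, C X → T X) ∧
  ∀ X, T X → ∃ (Cb X' : 𝒜) (f : X ⟶ Cb) (g : Cb ⟶ X') (w : f ≫ g = 0),
    C Cb ∧ T X' ∧ (ShortComplex.mk f g w).ShortExact

/-- `𝒯` is closed under `ℰ`-proper extensions. -/
def ClosedUnderProperExtensions (E T : 𝒜 → Prop) : Prop :=
  ∀ S : ShortComplex 𝒜, S.ShortExact → EProper E S → T S.X₁ → T S.X₃ → T S.X₂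

/-- `𝒯` is closed under kernels of `ℰ`-proper epimorphisms. -/
def ClosedUnderProperKernels (E T : 𝒜 → Prop) : Prop :=
  ∀ S : ShortComplex 𝒜, S.ShortExact → EProper E S → T S.X₂ → T S.X₃ → T S.X₁

/-- `𝒯` is an `ℰ`-preresolving subcategory with `ℰ`-proper generator `𝒞`. -/
def IsPreresolving (E T C : 𝒜 → Prop) : Prop :=
  IsProperGenerator E C T ∧ ClosedUnderProperExtensions E T


/-- Exactness of a four-term sequence `0 → M → T₁ → T₀ → A → 0`. -/
def FourTermExact {M T1 T0 A : 𝒜} (f : M ⟶ T1) (g : T1 ⟶ T0) (h : T0 ⟶ A) : Prop :=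
  Mono f ∧ Epi h ∧ ∃ (w₁ : f ≫ g = 0) (w₂ : g ≫ h = 0),
    (ShortComplex.mk f g w₁).Exact ∧ (ShortComplex.mk g h w₂).Exact

/-- `Hom(W,-)`-exactness of the four-term exact sequence `0 → M → T₁ → T₀ → A → 0` :
the induced sequence `0 → Hom(W,M) → Hom(W,T₁) → Hom(W,T₀) → Hom(W,A) → 0` is exact. -/
def CovHomExact4 (W : 𝒜) {M T1 T0 A : 𝒜} (f : M ⟶ T1) (g : T1 ⟶ T0) (h : T0 ⟶ A) : Prop :=
  (∀ a b : W ⟶ M, a ≫ f = b ≫ f → a = b) ∧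
  (∀ b : W ⟶ T1, b ≫ g = 0 → ∃ a : W ⟶ M, a ≫ f = b) ∧
  (∀ c : W ⟶ T0, c ≫ h = 0 → ∃ b : W ⟶ T1, b ≫ g = c) ∧
  (∀ d : W ⟶ A, ∃ c : W ⟶ T0, c ≫ h = d)

/-- There is an exact sequence `0 → M → K⁰ → C¹ → ⋯ → Cⁿ → 0` with `K⁰` in `T`
and all `C^i` in `C`. -/
def MixedCores (T C : 𝒜 → Prop) : ℕ → 𝒜 → Prop
  | 0 => fun M => ∃ K, T K ∧ Nonempty (M ≅ K)
  | n + 1 => fun M => ∃ (K H : 𝒜) (f : M ⟶ K) (g : K ⟶ H) (w : f ≫ g = 0),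
      T K ∧ (ShortComplex.mk f g w).ShortExact ∧ ∃ K', C K' ∧ Cores C n H K'

/-- The Gorenstein subcategory `𝒢(𝒞)` : objects `A` admitting a doubly infinite
exact sequence `⋯ → X_{-1} → X_0 → X_1 → ⋯` with all terms in `𝒞`, which is both
`Hom(𝒞,-)`-exact and `Hom(-,𝒞)`-exact, such that `A ≅ Im(X_0 → X_1)`. -/
def IsGorenstein (P : 𝒜 → Prop) (A : 𝒜) : Prop :=
  ∃ (X : ℤ → 𝒜) (d : ∀ i : ℤ, X i ⟶ X (i + 1)) (w : ∀ i, d i ≫ d (i + 1) = 0),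
    (∀ i, P (X i)) ∧
    (∀ i, (ShortComplex.mk (d i) (d (i + 1)) (w i)).Exact) ∧
    (∀ C, P C → ∀ (i : ℤ) (f : C ⟶ X (i + 1)), f ≫ d (i + 1) = 0 →
      ∃ g : C ⟶ X i, g ≫ d i = f) ∧
    (∀ C, P C → ∀ (i : ℤ) (f : X (i + 1) ⟶ C), d i ≫ f = 0 →
      ∃ g : X (i + 1 + 1) ⟶ C, d (i + 1) ≫ g = f) ∧
    Nonempty (A ≅ Limits.image (d 0))

end RelHomDim

namespace RelHomDim

variable {𝒜 : Type u} [Category.{v} 𝒜] [Abelian 𝒜]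

/-- The base change of a short exact sequence along a morphism to its last term. -/
theorem shortExact_of_isPullback {K X Q P B : 𝒜} {f : K ⟶ X} {g : X ⟶ Q} {w : f ≫ g = 0}
    (hS : (ShortComplex.mk f g w).ShortExact) {p : P ⟶ X} {q : P ⟶ B} {h : B ⟶ Q}
    (sq : IsPullback p q g h) :
    ∃ (j : K ⟶ P) (w' : j ≫ q = 0), j ≫ p = f ∧ (ShortComplex.mk j q w').ShortExact := by
  have : Mono f := hS.mono_f
  have : Epi g := hS.epi_g
  have hw : f ≫ g = 0 ≫ h := by rw [w, zero_comp]
  have hj : sq.lift f 0 hw ≫ p = f := sq.lift_fst _ _ _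
  have : Epi q := Abelian.epi_snd_of_isLimit g h sq.isLimit
  have : Mono (sq.lift f 0 hw) := mono_of_mono_fac hj
  refine ⟨sq.lift f 0 hw, sq.lift_snd _ _ _, hj, .mk ?_⟩
  refine ShortComplex.exact_of_f_is_kernel _ (KernelFork.IsLimit.ofι' _ _ fun {Y} y hy ↦ ?_)
  dsimp at y hy
  have hyg : (y ≫ p) ≫ g = 0 := by
    rw [Category.assoc, sq.w, ← Category.assoc, hy, zero_comp]
  obtain ⟨l, hl⟩ := KernelFork.IsLimit.lift' hS.fIsKernel (y ≫ p) hyg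
  dsimp at l hl
  refine ⟨l, sq.hom_ext ?_ ?_⟩
  · simpa [hj] using hl
  · simp [hy]

/-- A short exact sequence is `ℰ`-proper as soon as morphisms from objects of `ℰ` lift along its
epimorphism. -/
theorem EProper.of_lift {E : 𝒜 → Prop} {S : ShortComplex 𝒜} (hS : S.ShortExact)
    (h : ∀ W, E W → ∀ c : W ⟶ S.X₃, ∃ b : W ⟶ S.X₂, b ≫ S.g = c) : EProper E S := by
  intro W hW
  have := hS.mono_f
  refine ⟨fun a b hab ↦ (cancel_mono S.f).1 hab, fun b hb ↦ ?_, h W hW⟩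
  exact ⟨_, (KernelFork.IsLimit.lift' hS.fIsKernel b hb).2⟩

/-- `ℰ`-proper short exact sequences are stable under base change. -/
theorem EProper.of_isPullback {E : 𝒜 → Prop} {K X Q P B : 𝒜} {f : K ⟶ X} {g : X ⟶ Q}
    {w : f ≫ g = 0} (hE : EProper E (ShortComplex.mk f g w)) {p : P ⟶ X} {q : P ⟶ B} {h : B ⟶ Q}
    (sq : IsPullback p q g h) {j : K ⟶ P} {w' : j ≫ q = 0}
    (hS' : (ShortComplex.mk j q w').ShortExact) : EProper E (ShortComplex.mk j q w') := by
  refine .of_lift hS' fun W hW c ↦ ?_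
  obtain ⟨b, hb⟩ := (hE W hW).2.2 (c ≫ h)
  exact ⟨sq.lift b c hb, sq.lift_snd _ _ _⟩

/-- The kernel of a composite of epimorphisms `X ⟶ Q ⟶ A` is the base change of `X ⟶ Q` along the
kernel of `Q ⟶ A`. -/
theorem shortExact_comp_of_isPullback {X Q P B A : 𝒜} {g : X ⟶ Q} [Epi g] {i : B ⟶ Q} {r : Q ⟶ A}
    {w : i ≫ r = 0} (hS : (ShortComplex.mk i r w).ShortExact) {p : P ⟶ X} {q : P ⟶ B}
    (sq : IsPullback p q g i) :
    ∃ w' : p ≫ g ≫ r = 0, (ShortComplex.mk p (g ≫ r) w').ShortExact := by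
  have : Mono i := hS.mono_f
  have : Epi r := hS.epi_g
  have w' : p ≫ g ≫ r = 0 := by rw [← Category.assoc, sq.w, Category.assoc, w, comp_zero]
  have : Mono p := ⟨fun a b hab ↦ sq.hom_ext hab <| by
    rw [← cancel_mono i, Category.assoc, Category.assoc, ← sq.w, reassoc_of% hab]⟩
  have : Epi (g ≫ r) := epi_comp g r
  refine ⟨w', ShortComplex.ShortExact.mk ?_⟩
  refine ShortComplex.exact_of_f_is_kernel _ (KernelFork.IsLimit.ofι' _ _ fun {Y} y hy ↦ ?_)
  obtain ⟨l, hl⟩ := KernelFork.IsLimit.lift' hS.fIsKernel (y ≫ g) (by simpa using hy)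
  exact ⟨sq.lift y l hl.symm, sq.lift_fst _ _ _⟩

theorem Res.mono {P P' : 𝒜 → Prop} (h : ∀ ⦃X⦄, P X → P' X) {n : ℕ} {K A : 𝒜}
    (hA : Res P n K A) : Res P' n K A := by
  induction n generalizing A with
  | zero => exact hA
  | succ n ih =>
    obtain ⟨B, X, f, g, w, hX, hS, -, hB⟩ := hA
    exact ⟨B, X, f, g, w, h hX, hS, trivial, ih hB⟩

/-- A finite resolution can be prolonged by a zero object. -/
theorem Res.succ {P : 𝒜 → Prop} {n : ℕ} {K A : 𝒜} (hK : P K) (hA : Res P n K A) :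
    Res P (n + 1) 0 A := by
  induction n generalizing A with
  | zero =>
    obtain ⟨e⟩ := hA
    refine ⟨0, K, 0, e.hom, zero_comp, hK, ShortComplex.ShortExact.mk ?_, trivial, ⟨Iso.refl _⟩⟩
    exact (ShortComplex.exact_iff_mono _ rfl).2 (inferInstanceAs (Mono e.hom))
  | succ n ih =>
    obtain ⟨B, X, f, g, w, hX, hS, -, hB⟩ := hA
    exact ⟨B, X, f, g, w, hX, hS, trivial, ih hB⟩

theorem exists_res_of_le {P : 𝒜 → Prop} (h0 : P 0) {m n : ℕ} (hmn : m ≤ n) {A : 𝒜}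
    (hA : ∃ K, P K ∧ Res P m K A) : ∃ K, P K ∧ Res P n K A := by
  induction n, hmn using Nat.le_induction with
  | base => exact hA
  | succ n _ ih =>
    obtain ⟨K, hK, hA⟩ := ih
    exact ⟨0, h0, hA.succ hK⟩

theorem rdim_le_iff {P : 𝒜 → Prop} (h0 : P 0) {A : 𝒜} {n : ℕ} :
    rdim P A ≤ (n : ℕ∞) ↔ ∃ K, P K ∧ Res P n K A := by
  refine ⟨fun h ↦ ?_, fun h ↦ sInf_le ⟨n, rfl, h⟩⟩
  have hlt : rdim P A < ((n + 1 : ℕ) : ℕ∞) := h.trans_lt (by exact_mod_cast n.lt_succ_self)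
  obtain ⟨_, ⟨m, rfl, hA⟩, hm⟩ := sInf_lt_iff.1 hlt
  exact exists_res_of_le h0 (Nat.lt_succ_iff.1 (by exact_mod_cast hm)) hA

/-- If `𝒯` is closed under `ℰ`-proper extensions, then so is the class of objects having
a `𝒯`-resolution of length `n`, as long as the subobject lies in `𝒯`. -/
theorem exists_res_of_proper_extension {E T : 𝒜 → Prop}
    (hiso : ∀ ⦃X Y : 𝒜⦄, (X ≅ Y) → T X → T Y) (hext : ClosedUnderProperExtensions E T)
    {S : ShortComplex 𝒜} (hS : S.ShortExact) (hE : EProper E S) (h₁ : T S.X₁) {n : ℕ}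
    (h₃ : ∃ K, T K ∧ Res T n K S.X₃) : ∃ K, T K ∧ Res T n K S.X₂ := by
  obtain ⟨K, hK, h₃⟩ := h₃
  cases n with
  | zero =>
    obtain ⟨e⟩ := h₃
    exact ⟨S.X₂, hext S hS hE h₁ (hiso e hK), ⟨Iso.refl _⟩⟩
  | succ n =>
    obtain ⟨B, X, f, g, w, hX, hS', -, hB⟩ := h₃
    have sq := IsPullback.of_hasPullback S.g g
    obtain ⟨j, w₁, -, hj⟩ := shortExact_of_isPullback hS sq
    obtain ⟨k, w₂, -, hk⟩ := shortExact_of_isPullback hS' sq.flip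
    exact ⟨K, hK, B, _, k, _, w₂, hext _ hj (hE.of_isPullback sq hj) h₁ hX, hk, trivial, hB⟩

/-- In a finite resolution by objects of an `ℰ`-preresolving subcategory, all the terms but the
last one can be chosen in a given `ℰ`-proper generator. -/
theorem IsPreresolving.exists_res {E T C : 𝒜 → Prop} (h : IsPreresolving E T C)
    (hiso : ∀ ⦃X Y : 𝒜⦄, (X ≅ Y) → T X → T Y) {n : ℕ} {A : 𝒜}
    (hA : ∃ K, T K ∧ Res T n K A) : ∃ K, T K ∧ Res C n K A := by
  induction n generalizing A with
  | zero => exact hA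
  | succ n ih =>
    obtain ⟨K, hK, B, X, i, r, w, hX, hS, -, hB⟩ := hA
    obtain ⟨X', Y, f, g, w', hY, hX', hS', hE⟩ := h.1.2 X hX
    have : Epi g := hS'.epi_g
    have sq := IsPullback.of_hasPullback g i
    obtain ⟨j, w₁, -, hj⟩ := shortExact_of_isPullback hS' sq
    obtain ⟨w₂, hp⟩ := shortExact_comp_of_isPullback hS sq
    obtain ⟨L, hL, hres⟩ := ih (exists_res_of_proper_extension hiso h.2 hj
      (hE.of_isPullback sq hj) hX' ⟨K, hK, hB⟩)
    exact ⟨L, hL, _, Y, _, _, w₂, hY, hp, trivial, hres⟩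

end RelHomDim

open RelHomDim in
/-- Theorem 3.6. -/
theorem stmt8 {𝒜 : Type u} [Category.{v} 𝒜] [Abelian 𝒜]
    (ℰ 𝒯 𝒞 : 𝒜 → Prop) (hℰ : IsAdditiveClass ℰ) (h𝒯 : IsAdditiveClass 𝒯)
    (h𝒞 : IsAdditiveClass 𝒞) (hpre : IsPreresolving ℰ 𝒯 𝒞)
    (A : 𝒜) (n : ℕ) :
    rdim 𝒯 A ≤ (n : ℕ∞) ↔ ∃ K : 𝒜, 𝒯 K ∧ Res 𝒞 n K A := by
  rw [rdim_le_iff h𝒯.1]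
  exact ⟨hpre.exists_res h𝒯.2.1, fun ⟨K, hK, hA⟩ ↦ ⟨K, hK, hA.mono hpre.1.1⟩⟩
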